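/- arXiv:2410.21524 — 6 statements merged into one kernel-verified Lean document; each statement's English description precedes it below -/
import Mathlib

section
/- Let C be a symmetric monoidal closed category. A morphism f : x ⟶ y is trace-class if and only if there exists a morphism g : 𝟙 ⟶ [x, 𝟙] ⊗ y such that t_{x,y} ∘ g equals the classifying morphism ⌜f⌝ : 𝟙 ⟶ [x, y] of f. -/
open CategoryTheory MonoidalCategory MonoidalClosed

/-- A morphism `f : x ⟶ y` in a monoidal category is trace-class if there are
`d`, `ε : d ⊗ x ⟶ 𝟙` and `η : 𝟙 ⟶ y ⊗ d` such that `f` is the composite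
`x ≅ 𝟙 ⊗ x ⟶ (y ⊗ d) ⊗ x ≅ y ⊗ (d ⊗ x) ⟶ y ⊗ 𝟙 ≅ y`. -/
def TraceClass {C : Type*} [Category C] [MonoidalCategory C] {x y : C} (f : x ⟶ y) : Prop :=
  ∃ (d : C) (ε : d ⊗ x ⟶ 𝟙_ C) (η : 𝟙_ C ⟶ y ⊗ d),
    f = (λ_ x).inv ≫ η ▷ x ≫ (α_ y d x).hom ≫ y ◁ ε ≫ (ρ_ y).hom

/-- The canonical morphism `t_{x,y} : [x, 𝟙] ⊗ y ⟶ [x, y]`, the transpose under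
the tensor–hom adjunction of
`x ⊗ ([x, 𝟙] ⊗ y) ≅ (x ⊗ [x, 𝟙]) ⊗ y ⟶ 𝟙 ⊗ y ≅ y`. -/
noncomputable def tmap {C : Type*} [Category C] [MonoidalCategory C]
    [MonoidalClosed C] (x y : C) : (ihom x).obj (𝟙_ C) ⊗ y ⟶ (ihom x).obj y :=
  curry ((α_ x ((ihom x).obj (𝟙_ C)) y).inv ≫ (ihom.ev x).app (𝟙_ C) ▷ y ≫ (λ_ y).hom)

/-- The classifying morphism `⌜f⌝ : 𝟙 ⟶ [x, y]` of `f : x ⟶ y`, the transpose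
of `x ⊗ 𝟙 ≅ x ⟶ y`. -/
noncomputable def classify {C : Type*} [Category C] [MonoidalCategory C]
    [MonoidalClosed C] {x y : C} (f : x ⟶ y) : 𝟙_ C ⟶ (ihom x).obj y :=
  curry ((ρ_ x).hom ≫ f)

theorem aux_braid {C : Type*} [Category C] [MonoidalCategory C] [SymmetricCategory C] (d x y : C) :
    (β_ (d ⊗ y) x).hom ≫ (α_ x d y).inv ≫ (β_ (x ⊗ d) y).hom =
      (β_ d y).hom ▷ x ≫ (α_ y d x).hom ≫ y ◁ (β_ d x).hom := by
  have h := BraidedCategory.braiding_naturality_left (β_ d x).hom y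
  have h2 : (β_ (d ⊗ y) x).hom ≫ (α_ x d y).inv =
      (α_ d y x).hom ≫ d ◁ (β_ y x).hom ≫ (α_ d x y).inv ≫ (β_ d x).hom ▷ y := by
    simp [BraidedCategory.braiding_tensor_left_hom]
  rw [reassoc_of% h2, h, BraidedCategory.braiding_tensor_left_hom]
  simp only [Category.assoc, Iso.inv_hom_id_assoc]
  rw [← whiskerLeft_comp_assoc]
  simp

theorem aux_key {C : Type*} [Category C] [MonoidalCategory C] [SymmetricCategory C] {d x y : C}
    (e : x ⊗ d ⟶ 𝟙_ C) (g : 𝟙_ C ⟶ d ⊗ y) :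
    x ◁ g ≫ (α_ x d y).inv ≫ e ▷ y ≫ (λ_ y).hom =
      (ρ_ x).hom ≫ (λ_ x).inv ≫ (g ≫ (β_ d y).hom) ▷ x ≫ (α_ y d x).hom ≫
        y ◁ ((β_ d x).hom ≫ e) ≫ (ρ_ y).hom := by
  have h1 : (ρ_ x).hom ≫ (λ_ x).inv ≫ g ▷ x ≫ (β_ (d ⊗ y) x).hom = x ◁ g := by
    rw [BraidedCategory.braiding_naturality_left, braiding_tensorUnit_left]
    simp
  have h2 : (β_ (x ⊗ d) y).hom ≫ y ◁ e ≫ (ρ_ y).hom = e ▷ y ≫ (λ_ y).hom := by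
    rw [← BraidedCategory.braiding_naturality_left_assoc, braiding_tensorUnit_left]
    simp
  have h3 := aux_braid d x y
  rw [← h1, ← h2]
  simp only [comp_whiskerRight, whiskerLeft_comp, Category.assoc]
  rw [← reassoc_of% h3]

/-- In a symmetric monoidal closed category, `f : x ⟶ y` is trace-class iff its
classifying morphism `𝟙 ⟶ [x,y]` lifts through `t_{x,y} : [x,𝟙] ⊗ y ⟶ [x,y]`. -/
theorem stmt_2 {C : Type*} [Category C] [MonoidalCategory C] [SymmetricCategory C]
    [MonoidalClosed C] {x y : C} (f : x ⟶ y) :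
    TraceClass f ↔ ∃ g : 𝟙_ C ⟶ (ihom x).obj (𝟙_ C) ⊗ y, g ≫ tmap x y = classify f := by
  have hg : ∀ g : 𝟙_ C ⟶ (ihom x).obj (𝟙_ C) ⊗ y, g ≫ tmap x y = classify f ↔
      x ◁ g ≫ (α_ x ((ihom x).obj (𝟙_ C)) y).inv ≫ (ihom.ev x).app (𝟙_ C) ▷ y ≫ (λ_ y).hom =
        (ρ_ x).hom ≫ f := by
    intro g
    unfold tmap classify
    rw [← curry_natural_left]
    exact curry_injective.eq_iff
  constructor
  · rintro ⟨d, ε, η, hf⟩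
    let k : d ⟶ (ihom x).obj (𝟙_ C) := curry ((β_ x d).hom ≫ ε)
    have hk : x ◁ k ≫ (ihom.ev x).app (𝟙_ C) = (β_ x d).hom ≫ ε := by
      rw [← uncurry_eq, uncurry_curry]
    refine ⟨η ≫ (β_ y d).hom ≫ k ▷ y, (hg _).2 ?_⟩
    have h := aux_key ((β_ x d).hom ≫ ε) (η ≫ (β_ y d).hom)
    have e1 : (η ≫ (β_ y d).hom) ≫ (β_ d y).hom = η := by simp
    have e2 : (β_ d x).hom ≫ (β_ x d).hom ≫ ε = ε := by simp
    rw [e1, e2, ← hf, ← hk] at h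
    rw [← h]
    simp
  · rintro ⟨g, h⟩
    rw [hg, aux_key] at h
    exact ⟨_, _, _, ((cancel_epi _).1 h).symm⟩
end

section
/- Let C be a symmetric monoidal closed category, and let x, y, z be objects of C. Let f₀, f₁ : 𝟙 ⟶ [x, 𝟙] ⊗ y be two morphisms such that t_{x,y} ∘ f₀ = t_{x,y} ∘ f₁ (i.e. f₀ and f₁ are two lifts of the same morphism 𝟙 ⟶ [x, y]). If g : y ⟶ z is a trace-class morphism, then (id_{[x,𝟙]} ⊗ g) ∘ f₀ = (id_{[x,𝟙]} ⊗ g) ∘ f₁ as morphisms 𝟙 ⟶ [x, 𝟙] ⊗ z. -/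
open CategoryTheory MonoidalCategory MonoidalClosed

theorem claimA {C : Type*} [Category C] [MonoidalCategory C] [BraidedCategory C]
    {x D y d : C} (e : x ⊗ D ⟶ 𝟙_ C) (ε : d ⊗ y ⟶ 𝟙_ C) :
    (α_ x d (D ⊗ y)).inv ≫ (β_ x d).hom ▷ (D ⊗ y) ≫ (α_ d x (D ⊗ y)).hom ≫
      d ◁ ((α_ x D y).inv ≫ e ▷ y ≫ (λ_ y).hom) ≫ ε =
    x ◁ ((α_ d D y).inv ≫ (β_ D d).inv ▷ y ≫ (α_ D d y).hom ≫ D ◁ ε ≫ (ρ_ D).hom) ≫ e := by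
  have h1 : (α_ x D d).inv ≫ (β_ (x ⊗ D) d).hom =
      x ◁ (β_ D d).hom ≫ (α_ x d D).inv ≫ (β_ x d).hom ▷ D ≫ (α_ d x D).hom := by
    simp
  have h2 : (α_ x d D).inv ≫ (β_ x d).hom ▷ D ≫ (α_ d x D).hom ≫ d ◁ e =
      x ◁ (β_ D d).inv ≫ (α_ x D d).inv ≫ e ▷ d ≫ (λ_ d).hom ≫ (ρ_ d).inv := by
    have h3 : e ▷ d ≫ (λ_ d).hom ≫ (ρ_ d).inv = (β_ (x ⊗ D) d).hom ≫ d ◁ e := by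
      rw [← BraidedCategory.braiding_naturality_left]; simp
    rw [h3, reassoc_of% h1]; simp
  calc _ = 𝟙 _ ⊗≫ ((α_ x d D).inv ≫ (β_ x d).hom ▷ D ≫ (α_ d x D).hom ≫ d ◁ e) ▷ y ⊗≫ ε := by
        monoidal
    _ = 𝟙 _ ⊗≫ x ◁ (β_ D d).inv ▷ y ⊗≫ (e ▷ (d ⊗ y) ≫ 𝟙_ C ◁ ε) ⊗≫ 𝟙 _ := by
        rw [h2]; monoidal
    _ = _ := by
        rw [← whisker_exchange]; monoidal

theorem claimB {C : Type*} [Category C] [MonoidalCategory C] [BraidedCategory C]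
    {z D y d : C} (η : 𝟙_ C ⟶ z ⊗ d) (ε : d ⊗ y ⟶ 𝟙_ C) :
    (λ_ (D ⊗ y)).inv ≫ η ▷ (D ⊗ y) ≫ (α_ z d (D ⊗ y)).hom ≫
      z ◁ ((α_ d D y).inv ≫ (β_ D d).inv ▷ y ≫ (α_ D d y).hom ≫ D ◁ ε ≫ (ρ_ D).hom) ≫
      (β_ D z).inv =
    D ◁ ((λ_ y).inv ≫ η ▷ y ≫ (α_ z d y).hom ≫ z ◁ ε ≫ (ρ_ z).hom) := by
  have h1 : (α_ z d D).hom ≫ z ◁ (β_ D d).inv ≫ (α_ z D d).inv ≫ (β_ D z).inv ▷ d =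
      (β_ D (z ⊗ d)).inv ≫ (α_ D z d).inv := by
    simp
  have h2 : η ▷ D ≫ (β_ D (z ⊗ d)).inv = (λ_ D).hom ≫ (ρ_ D).inv ≫ D ◁ η := by
    rw [BraidedCategory.braiding_inv_naturality_left]; simp [← Category.assoc, Iso.inv_comp_eq]
  calc _ = 𝟙 _ ⊗≫ η ▷ D ▷ y ⊗≫ z ◁ (β_ D d).inv ▷ y ⊗≫
          ((z ⊗ D) ◁ ε ≫ (β_ D z).inv ▷ 𝟙_ C) ⊗≫ 𝟙 _ := by
        monoidal
    _ = 𝟙 _ ⊗≫ (η ▷ D ≫ (α_ z d D).hom ≫ z ◁ (β_ D d).inv ≫ (α_ z D d).inv ≫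
          (β_ D z).inv ▷ d) ▷ y ⊗≫ D ◁ z ◁ ε ⊗≫ 𝟙 _ := by
        rw [whisker_exchange]; monoidal
    _ = _ := by
        rw [h1, reassoc_of% h2]; monoidal

/-- If `f₀, f₁ : 𝟙 ⟶ [x,𝟙] ⊗ y` are two lifts of the same morphism `𝟙 ⟶ [x,y]`
along `t_{x,y}`, and `g : y ⟶ z` is trace-class, then
`(id ⊗ g) ∘ f₀ = (id ⊗ g) ∘ f₁`. -/
theorem stmt_6 {C : Type*} [Category C] [MonoidalCategory C] [SymmetricCategory C]
    [MonoidalClosed C] (x y z : C)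
    (f₀ f₁ : 𝟙_ C ⟶ (ihom x).obj (𝟙_ C) ⊗ y)
    (h : f₀ ≫ tmap x y = f₁ ≫ tmap x y)
    (g : y ⟶ z) (hg : TraceClass g) :
    f₀ ≫ (ihom x).obj (𝟙_ C) ◁ g = f₁ ≫ (ihom x).obj (𝟙_ C) ◁ g := by
  obtain ⟨d, ε, η, rfl⟩ := hg
  let s : d ⊗ (ihom x).obj y ⟶ (ihom x).obj (𝟙_ C) :=
    curry ((α_ x d _).inv ≫ (β_ x d).hom ▷ _ ≫ (α_ d x _).hom ≫ d ◁ (ihom.ev x).app y ≫ ε)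
  have ht : x ◁ tmap x y ≫ (ihom.ev x).app y =
      (α_ x ((ihom x).obj (𝟙_ C)) y).inv ≫ (ihom.ev x).app (𝟙_ C) ▷ y ≫ (λ_ y).hom := by
    rw [← uncurry_eq, tmap, uncurry_curry]
  have hA : d ◁ tmap x y ≫ s = (α_ d _ y).inv ≫ (β_ _ d).inv ▷ y ≫ (α_ _ d y).hom ≫
      (ihom x).obj (𝟙_ C) ◁ ε ≫ (ρ_ _).hom := by
    apply uncurry_injective
    rw [uncurry_natural_left, uncurry_curry, uncurry_eq, ← claimA, ← ht]
    simp only [MonoidalCategory.whiskerLeft_comp, Category.assoc]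
    rw [associator_inv_naturality_right_assoc, whisker_exchange_assoc,
      associator_naturality_right_assoc]
  have hB : (ihom x).obj (𝟙_ C) ◁ ((λ_ y).inv ≫ η ▷ y ≫ (α_ z d y).hom ≫ z ◁ ε ≫ (ρ_ z).hom) =
      tmap x y ≫ (λ_ _).inv ≫ η ▷ _ ≫ (α_ z d _).hom ≫ z ◁ s ≫ (β_ _ z).inv := by
    rw [← claimB, ← hA]
    simp only [MonoidalCategory.whiskerLeft_comp, Category.assoc]
    rw [leftUnitor_inv_naturality_assoc, whisker_exchange_assoc,
      associator_naturality_right_assoc]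
  rw [hB, reassoc_of% h]
end

section
/- Let C and D be monoidal categories, F : C ⥤ D a strong monoidal functor, and F ⊣ G an adjunction. If an object x of C admits a right dual xᘁ (i.e. there is an exact pairing with coevaluation 𝟙 ⟶ x ⊗ xᘁ and evaluation xᘁ ⊗ x ⟶ 𝟙 satisfying the two zigzag identities), then for every object d of D the projection morphism π_{x,d} : x ⊗ G(d) ⟶ G(F(x) ⊗ d) is an isomorphism. -/
open CategoryTheory MonoidalCategory

/-- The projection morphism `π_{x,d} : x ⊗ G(d) ⟶ G(F(x) ⊗ d)` associated to an
adjunction `F ⊣ G` with `F` strong monoidal: the transpose of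
`F(x ⊗ G(d)) ≅ F(x) ⊗ F(G(d)) ⟶ F(x) ⊗ d`. -/
noncomputable def projectionMorphism {C D : Type*} [Category C] [MonoidalCategory C]
    [Category D] [MonoidalCategory D] (F : C ⥤ D) [F.Monoidal] (G : D ⥤ C)
    (adj : F ⊣ G) (x : C) (d : D) : x ⊗ G.obj d ⟶ G.obj (F.obj x ⊗ d) :=
  adj.homEquiv _ _ (Functor.OplaxMonoidal.δ F x (G.obj d) ≫ F.obj x ◁ adj.counit.app d)

open Functor.LaxMonoidal Functor.OplaxMonoidal Functor.Monoidal in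
/-- A strong monoidal functor preserves exact pairings. -/
@[reducible]
noncomputable def mapExactPairing {C D : Type*} [Category C] [MonoidalCategory C]
    [Category D] [MonoidalCategory D] (F : C ⥤ D) [F.Monoidal] (x y : C)
    [ExactPairing x y] : ExactPairing (F.obj x) (F.obj y) where
  coevaluation' := ε F ≫ F.map (ExactPairing.coevaluation x y) ≫ δ F x y
  evaluation' := μ F y x ≫ F.map (ExactPairing.evaluation x y) ≫ η F
  coevaluation_evaluation' := by
    have h := congrArg F.map (ExactPairing.coevaluation_evaluation x y)
    simp only [Functor.map_comp, map_whiskerLeft, map_whiskerRight, map_associator_inv,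
      map_rightUnitor, map_leftUnitor_inv, Category.assoc, μ_δ_assoc] at h
    rw [← cancel_epi (δ F y (𝟙_ C) ≫ F.obj y ◁ η F),
      ← cancel_mono (ε F ▷ F.obj y ≫ μ F (𝟙_ C) y)]
    simpa only [MonoidalCategory.whiskerLeft_comp, comp_whiskerRight, Category.assoc,
      whiskerLeft_η_ε_assoc, whiskerRight_η_ε_assoc] using h
  evaluation_coevaluation' := by
    have h := congrArg F.map (ExactPairing.evaluation_coevaluation x y)
    simp only [Functor.map_comp, map_whiskerLeft, map_whiskerRight, map_associator,
      map_leftUnitor, map_rightUnitor_inv, Category.assoc, μ_δ_assoc] at h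
    rw [← cancel_epi (δ F (𝟙_ C) x ≫ η F ▷ F.obj x),
      ← cancel_mono (F.obj x ◁ ε F ≫ μ F x (𝟙_ C))]
    simpa only [MonoidalCategory.whiskerLeft_comp, comp_whiskerRight, Category.assoc,
      whiskerLeft_η_ε_assoc, whiskerRight_η_ε_assoc] using h

open Functor.LaxMonoidal Functor.OplaxMonoidal Functor.Monoidal in
theorem projection_aux {C D : Type*} [Category C] [MonoidalCategory C]
    [Category D] [MonoidalCategory D] (F : C ⥤ D) [F.Monoidal] (x y : C)
    [ExactPairing x y] (z w : C) (d : D) (g : y ⊗ z ⟶ w) (c : F.obj w ⟶ d) :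
    letI := mapExactPairing F x y
    F.map (tensorLeftHomEquiv z x y w g) ≫ δ F x w ≫ F.obj x ◁ c =
      tensorLeftHomEquiv (F.obj z) (F.obj x) (F.obj y) d (μ F y z ≫ F.map g ≫ c) := by
  letI := mapExactPairing F x y
  change F.map ((λ_ _).inv ≫ ExactPairing.coevaluation x y ▷ _ ≫ (α_ _ _ _).hom ≫ _ ◁ g) ≫ _ =
    (λ_ _).inv ≫ (ε F ≫ F.map (ExactPairing.coevaluation x y) ≫ δ F x y) ▷ _ ≫
      (α_ _ _ _).hom ≫ _ ◁ (μ F y z ≫ F.map g ≫ c)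
  simp only [Functor.map_comp, map_whiskerLeft, map_whiskerRight, map_associator,
    map_leftUnitor_inv, Category.assoc, μ_δ_assoc, MonoidalCategory.whiskerLeft_comp,
    comp_whiskerRight]

/-- If `x` admits a right dual, then the projection morphism
`π_{x,d} : x ⊗ G(d) ⟶ G(F(x) ⊗ d)` is an isomorphism for every `d`. -/
theorem stmt_7 {C D : Type*} [Category C] [MonoidalCategory C]
    [Category D] [MonoidalCategory D] (F : C ⥤ D) [F.Monoidal] (G : D ⥤ C)
    (adj : F ⊣ G) (x : C) (h : ∃ xd : C, Nonempty (ExactPairing x xd)) (d : D) :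
    IsIso (projectionMorphism F G adj x d) := by
  obtain ⟨y, ⟨hp⟩⟩ := h
  letI := mapExactPairing F x y
  rw [isIso_iff_yoneda_map_bijective]
  intro z
  let e : (z ⟶ x ⊗ G.obj d) ≃ (z ⟶ G.obj (F.obj x ⊗ d)) :=
    (tensorLeftHomEquiv z x y (G.obj d)).symm.trans
      ((adj.homEquiv _ _).symm.trans
        (((Functor.Monoidal.μIso F y z).symm.homCongr (Iso.refl d)).trans
          ((tensorLeftHomEquiv (F.obj z) (F.obj x) (F.obj y) d).trans (adj.homEquiv _ _))))
  have he : (fun f : z ⟶ x ⊗ G.obj d => f ≫ projectionMorphism F G adj x d) = e := by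
    funext f
    obtain ⟨g, rfl⟩ := (tensorLeftHomEquiv z x y (G.obj d)).surjective f
    have := projection_aux F x y z _ d g (adj.counit.app d)
    simp only [projectionMorphism, ← Adjunction.homEquiv_naturality_left, this]
    simp [e, Adjunction.homEquiv_counit, Iso.homCongr]
  rw [he]
  exact e.bijective
end

section
/- Let C and D be monoidal categories, F : C ⥤ D a strong monoidal functor, and F ⊣ G an adjunction. If f : x ⟶ y is a trace-class morphism in C, then for every object d of D there exists a morphism h : G(F(x) ⊗ d) ⟶ y ⊗ G(d) such that h ∘ π_{x,d} = f ⊗ id_{G(d)} and π_{y,d} ∘ h = G(F(f) ⊗ id_d); that is, h is a diagonal filler for the naturality square of the projection morphism at f. -/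
open CategoryTheory MonoidalCategory

section Aux

variable {C D : Type*} [Category C] [MonoidalCategory C]
    [Category D] [MonoidalCategory D] (F : C ⥤ D) [F.Monoidal] (G : D ⥤ C)
    (adj : F ⊣ G)

open Functor.OplaxMonoidal Functor.LaxMonoidal Functor.Monoidal

/-- The counit with its source and target in simplified form. -/
def cu (d : D) : F.obj (G.obj d) ⟶ d := adj.counit.app d

theorem cu_nat {d d' : D} (g : d ⟶ d') :
    F.map (G.map g) ≫ cu F G adj d' = cu F G adj d ≫ g :=
  adj.counit_naturality g

theorem pm_transpose (x : C) (d : D) :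
    F.map (projectionMorphism F G adj x d) ≫ cu F G adj _ =
      δ F x (G.obj d) ≫ F.obj x ◁ cu F G adj d := by
  exact (adj.homEquiv_counit _ _ _).symm.trans ((adj.homEquiv _ _).symm_apply_apply _)

theorem pm_ext {c : C} {d : D} {a b : c ⟶ G.obj d}
    (h : F.map a ≫ cu F G adj d = F.map b ≫ cu F G adj d) : a = b := by
  apply (adj.homEquiv _ _).symm.injective
  rw [adj.homEquiv_counit, adj.homEquiv_counit]
  exact h

theorem pm_transpose_map (x : C) {d : D} {d' : D} (g : F.obj x ⊗ d ⟶ d') :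
    F.map (projectionMorphism F G adj x d ≫ G.map g) ≫ cu F G adj _ =
      δ F x (G.obj d) ≫ F.obj x ◁ cu F G adj d ≫ g := by
  rw [Functor.map_comp, Category.assoc, cu_nat, ← Category.assoc,
    pm_transpose, Category.assoc]

theorem pm_nat_left {x y : C} (f : x ⟶ y) (d : D) :
    f ▷ G.obj d ≫ projectionMorphism F G adj y d =
      projectionMorphism F G adj x d ≫ G.map (F.map f ▷ d) := by
  apply pm_ext F G adj
  rw [pm_transpose_map, Functor.map_comp, Category.assoc, pm_transpose,
    ← δ_natural_left_assoc, whisker_exchange]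

theorem pm_nat_right (x : C) {d d' : D} (g : d ⟶ d') :
    x ◁ G.map g ≫ projectionMorphism F G adj x d' =
      projectionMorphism F G adj x d ≫ G.map (F.obj x ◁ g) := by
  apply pm_ext F G adj
  rw [pm_transpose_map, Functor.map_comp, Category.assoc, pm_transpose,
    ← δ_natural_right_assoc, ← whiskerLeft_comp, ← whiskerLeft_comp,
    cu_nat]

theorem pm_assoc (x y : C) (d : D) :
    x ◁ projectionMorphism F G adj y d ≫ projectionMorphism F G adj x (F.obj y ⊗ d) =
      (α_ _ _ _).inv ≫ projectionMorphism F G adj (x ⊗ y) d ≫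
        G.map (δ F x y ▷ d ≫ (α_ _ _ _).hom) := by
  apply pm_ext F G adj
  rw [Functor.map_comp, Category.assoc, pm_transpose, Functor.map_comp (f := (α_ _ _ _).inv),
    Category.assoc, pm_transpose_map,
    ← δ_natural_right_assoc, ← whiskerLeft_comp, pm_transpose]
  simp only [whiskerLeft_comp, whisker_exchange_assoc]
  simp

theorem pm_unit (d : D) :
    projectionMorphism F G adj (𝟙_ C) d ≫ G.map (η F ▷ d ≫ (λ_ d).hom) =
      (λ_ (G.obj d)).hom := by
  apply pm_ext F G adj
  rw [pm_transpose_map]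
  rw [whisker_exchange_assoc]
  simp

end Aux

/-- If `f : x ⟶ y` is trace-class, then for every `d` there is a diagonal
filler `h : G(F(x) ⊗ d) ⟶ y ⊗ G(d)` for the naturality square of the
projection morphism at `f`. -/
theorem stmt_8 {C D : Type*} [Category C] [MonoidalCategory C]
    [Category D] [MonoidalCategory D] (F : C ⥤ D) [F.Monoidal] (G : D ⥤ C)
    (adj : F ⊣ G) {x y : C} (f : x ⟶ y) (hf : TraceClass f) (d : D) :
    ∃ h : G.obj (F.obj x ⊗ d) ⟶ y ⊗ G.obj d,
      projectionMorphism F G adj x d ≫ h = f ▷ G.obj d ∧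
      h ≫ projectionMorphism F G adj y d = G.map (F.map f ▷ d) := by
  obtain ⟨e, ev, co, rfl⟩ := hf
  let m : F.obj e ⊗ (F.obj x ⊗ d) ⟶ d :=
    (α_ _ _ _).inv ≫ Functor.LaxMonoidal.μ F e x ▷ d ≫ F.map ev ▷ d ≫
      Functor.OplaxMonoidal.η F ▷ d ≫ (λ_ d).hom
  have hk : e ◁ projectionMorphism F G adj x d ≫
      projectionMorphism F G adj e (F.obj x ⊗ d) ≫ G.map m =
      (α_ _ _ _).inv ≫ ev ▷ G.obj d ≫ (λ_ _).hom := by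
    rw [← pm_unit F G adj d, ← Category.assoc (ev ▷ G.obj d), pm_nat_left,
      ← Category.assoc, pm_assoc]
    simp only [Category.assoc, ← G.map_comp, m, Iso.hom_inv_id_assoc]
    simp
  refine ⟨(λ_ _).inv ≫ co ▷ _ ≫ (α_ _ _ _).hom ≫
    y ◁ (projectionMorphism F G adj e (F.obj x ⊗ d) ≫ G.map m), ?_, ?_⟩
  · rw [leftUnitor_inv_naturality_assoc, whisker_exchange_assoc,
      associator_naturality_right_assoc, ← whiskerLeft_comp, hk]
    monoidal
  · simp only [Category.assoc, whiskerLeft_comp]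
    rw [pm_nat_right, ← Category.assoc (y ◁ _), pm_assoc]
    simp only [Category.assoc, Iso.hom_inv_id_assoc]
    rw [← Category.assoc (co ▷ _), pm_nat_left]
    have hu := pm_unit F G adj (F.obj x ⊗ d)
    have hu' : (λ_ (G.obj (F.obj x ⊗ d))).inv ≫ projectionMorphism F G adj (𝟙_ C) (F.obj x ⊗ d)
        = G.map ((λ_ _).inv ≫ Functor.LaxMonoidal.ε F ▷ _) := by
      rw [Iso.inv_comp_eq, ← hu, Category.assoc, ← G.map_comp, Category.assoc,
        Iso.hom_inv_id_assoc, Functor.Monoidal.whiskerRight_η_ε, G.map_id, Category.comp_id]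
    rw [Category.assoc, reassoc_of% hu']
    simp only [← G.map_comp]
    congr 1
    have hF : F.map ((λ_ x).inv ≫ co ▷ x ≫ (α_ y e x).hom ≫ y ◁ ev ≫ (ρ_ y).hom) =
        (λ_ _).inv ≫ Functor.LaxMonoidal.ε F ▷ _ ≫ F.map co ▷ _ ≫
          Functor.OplaxMonoidal.δ F y e ▷ _ ≫ (α_ _ _ _).hom ≫
          F.obj y ◁ Functor.LaxMonoidal.μ F e x ≫ F.obj y ◁ F.map ev ≫
          F.obj y ◁ Functor.OplaxMonoidal.η F ≫ (ρ_ _).hom := by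
      simp only [Functor.map_comp, Functor.Monoidal.map_whiskerRight,
        Functor.Monoidal.map_whiskerLeft, Functor.Monoidal.map_associator,
        Functor.Monoidal.map_leftUnitor_inv, Functor.Monoidal.map_rightUnitor, Category.assoc,
        Functor.Monoidal.μ_δ_assoc]
    rw [hF]
    simp only [m]
    monoidal
end

section
/- Let C and D be monoidal categories, let F, G : C ⥤ D be strong monoidal functors, and let η : F ⟶ G be a monoidal natural transformation. If α : x ⟶ y is a trace-class morphism in C, then there exists a morphism δ : G(x) ⟶ F(y) such that δ ∘ η_x = F(α) and η_y ∘ δ = G(α). -/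
open CategoryTheory MonoidalCategory

open Functor.LaxMonoidal Functor.OplaxMonoidal in
/-- Strong monoidal functors preserve trace-class data. -/
theorem map_traceClass_aux {C D : Type*} [Category C] [MonoidalCategory C]
    [Category D] [MonoidalCategory D] (F : C ⥤ D) [F.Monoidal]
    {x y d : C} (e : d ⊗ x ⟶ 𝟙_ C) (h : 𝟙_ C ⟶ y ⊗ d) :
    F.map ((λ_ x).inv ≫ h ▷ x ≫ (α_ y d x).hom ≫ y ◁ e ≫ (ρ_ y).hom) =
      (λ_ (F.obj x)).inv ≫ (ε F ≫ F.map h ≫ δ F y d) ▷ F.obj x ≫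
        (α_ (F.obj y) (F.obj d) (F.obj x)).hom ≫
        F.obj y ◁ (μ F d x ≫ F.map e ≫ Functor.OplaxMonoidal.η F) ≫ (ρ_ (F.obj y)).hom := by
  simp only [Functor.map_comp, Functor.Monoidal.map_whiskerRight, Functor.Monoidal.map_whiskerLeft,
    Functor.Monoidal.map_associator, Functor.Monoidal.map_leftUnitor_inv,
    Functor.Monoidal.map_rightUnitor, comp_whiskerRight, MonoidalCategory.whiskerLeft_comp,
    Category.assoc, Functor.Monoidal.μ_δ_assoc]

/-- If `η : F ⟶ G` is a monoidal natural transformation between strong monoidal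
functors and `α : x ⟶ y` is trace-class, then there is a diagonal filler
`δ : G(x) ⟶ F(y)` with `δ ∘ η_x = F(α)` and `η_y ∘ δ = G(α)`. -/
theorem stmt_10 {C D : Type*} [Category C] [MonoidalCategory C]
    [Category D] [MonoidalCategory D]
    (F G : C ⥤ D) [F.Monoidal] [G.Monoidal]
    (η : F ⟶ G) [NatTrans.IsMonoidal η]
    {x y : C} (α : x ⟶ y) (hα : TraceClass α) :
    ∃ δ : G.obj x ⟶ F.obj y, η.app x ≫ δ = F.map α ∧ δ ≫ η.app y = G.map α := by
  obtain ⟨d, e, h, rfl⟩ := hα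
  have hev : Functor.LaxMonoidal.μ F d x ≫ F.map e ≫ Functor.OplaxMonoidal.η F =
      η.app d ▷ F.obj x ≫ G.obj d ◁ η.app x ≫
        Functor.LaxMonoidal.μ G d x ≫ G.map e ≫ Functor.OplaxMonoidal.η G := by
    have h1 := NatTrans.IsMonoidal.tensor (τ := η) d x
    have h2 := NatTrans.IsMonoidal.unit (τ := η)
    have h3 : Functor.OplaxMonoidal.η F = η.app (𝟙_ C) ≫ Functor.OplaxMonoidal.η G := by
      rw [← cancel_epi (Functor.LaxMonoidal.ε F), reassoc_of% h2]
      simp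
    rw [MonoidalCategory.tensorHom_def, Category.assoc] at h1
    rw [h3, ← reassoc_of% h1, NatTrans.naturality_assoc]
  have hco : Functor.LaxMonoidal.ε G ≫ G.map h ≫ Functor.OplaxMonoidal.δ G y d =
      (Functor.LaxMonoidal.ε F ≫ F.map h ≫ Functor.OplaxMonoidal.δ F y d) ≫
        F.obj y ◁ η.app d ≫ η.app y ▷ G.obj d := by
    have h1 := NatTrans.IsMonoidal.tensor (τ := η) y d
    have h2 := NatTrans.IsMonoidal.unit (τ := η)
    have h3 : η.app (y ⊗ d) ≫ Functor.OplaxMonoidal.δ G y d =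
        Functor.OplaxMonoidal.δ F y d ≫ (η.app y ⊗ₘ η.app d) := by
      rw [← cancel_epi (Functor.LaxMonoidal.μ F y d), reassoc_of% h1]
      simp
    rw [← h2, Category.assoc, ← NatTrans.naturality_assoc, h3, MonoidalCategory.tensorHom_def']
    simp only [Category.assoc]
  rw [map_traceClass_aux, map_traceClass_aux, hev, hco]
  generalize Functor.LaxMonoidal.ε F ≫ F.map h ≫ Functor.OplaxMonoidal.δ F y d = c
  generalize Functor.LaxMonoidal.μ G d x ≫ G.map e ≫ Functor.OplaxMonoidal.η G = v
  refine ⟨(λ_ (G.obj x)).inv ≫ c ▷ G.obj x ≫ (α_ _ _ _).hom ≫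
    F.obj y ◁ (η.app d ▷ G.obj x ≫ v) ≫ (ρ_ _).hom, ?_, ?_⟩
  · rw [leftUnitor_inv_naturality_assoc, whisker_exchange_assoc,
      ← whisker_exchange_assoc (η.app d) (η.app x)]
    simp
  · simp only [comp_whiskerRight, Category.assoc, MonoidalCategory.whiskerLeft_comp,
      ← rightUnitor_naturality, associator_naturality_left_assoc,
      associator_naturality_middle_assoc, whisker_exchange_assoc]
end

section
/- Let C be a symmetric monoidal closed category. An object x of C admits a right dual (i.e. there exists an object xᘁ together with an exact pairing: morphisms coev : 𝟙 ⟶ x ⊗ xᘁ and ev : xᘁ ⊗ x ⟶ 𝟙 satisfying the two zigzag identities) if and only if the identity morphism of x is trace-class. -/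
open CategoryTheory MonoidalCategory

theorem zigzag_aux {C : Type*} [Category C] [MonoidalCategory C] {X Y : C}
    (η : 𝟙_ C ⟶ X ⊗ Y) (ε : Y ⊗ X ⟶ 𝟙_ C)
    (h : η ▷ X ≫ (α_ _ _ _).hom ≫ X ◁ ε = (λ_ X).hom ≫ (ρ_ X).inv)
    (inj : ∀ f g : Y ⟶ Y, f ▷ X ≫ ε = g ▷ X ≫ ε → f = g) :
    Y ◁ η ≫ (α_ _ _ _).inv ≫ ε ▷ Y = (ρ_ Y).hom ≫ (λ_ Y).inv := by
  have key : (ρ_ Y).inv ≫ (Y ◁ η ≫ (α_ _ _ _).inv ≫ ε ▷ Y) ≫ (λ_ Y).hom = 𝟙 Y := by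
    apply inj
    calc _ = 𝟙 _ ⊗≫ Y ◁ η ▷ X ⊗≫ (ε ▷ (Y ⊗ X) ≫ 𝟙_ C ◁ ε) ⊗≫ 𝟙 _ := by monoidal
      _ = 𝟙 _ ⊗≫ Y ◁ η ▷ X ⊗≫ ((Y ⊗ X) ◁ ε ≫ ε ▷ 𝟙_ C) ⊗≫ 𝟙 _ := by
        rw [whisker_exchange]
      _ = 𝟙 _ ⊗≫ Y ◁ (η ▷ X ≫ (α_ _ _ _).hom ≫ X ◁ ε) ⊗≫ ε ⊗≫ 𝟙 _ := by monoidal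
      _ = _ := by rw [h]; monoidal
  rw [← cancel_mono (λ_ Y).hom, ← cancel_epi (ρ_ Y).inv, key]
  simp

/-- In a symmetric monoidal closed category, an object `x` admits a right dual
iff its identity morphism is trace-class. -/
theorem stmt_14 {C : Type*} [Category C] [MonoidalCategory C] [SymmetricCategory C]
    [MonoidalClosed C] (x : C) :
    (∃ xd : C, Nonempty (ExactPairing x xd)) ↔ TraceClass (𝟙 x) := by
  constructor
  · rintro ⟨xd, ⟨p⟩⟩
    refine ⟨xd, ExactPairing.evaluation x xd, ExactPairing.coevaluation x xd, ?_⟩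
    simp
  · rintro ⟨d, ε, η, h⟩
    let D : C := (ihom x).obj (𝟙_ C)
    let e : D ⊗ x ⟶ 𝟙_ C := (β_ D x).hom ≫ (ihom.ev x).app (𝟙_ C)
    let φ : d ⟶ D := MonoidalClosed.curry ((β_ x d).hom ≫ ε)
    have hφ : φ ▷ x ≫ e = ε := by
      simp only [e, φ, BraidedCategory.braiding_naturality_left_assoc]
      rw [← MonoidalClosed.uncurry_eq, MonoidalClosed.uncurry_curry]
      simp
    have inj : ∀ f g : D ⟶ D, f ▷ x ≫ e = g ▷ x ≫ e → f = g := by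
      intro f g hfg
      simp only [e, BraidedCategory.braiding_naturality_left_assoc] at hfg
      rw [cancel_epi, ← MonoidalClosed.uncurry_eq, ← MonoidalClosed.uncurry_eq] at hfg
      exact MonoidalClosed.uncurry_injective hfg
    have hz : (η ≫ x ◁ φ) ▷ x ≫ (α_ _ _ _).hom ≫ x ◁ e = (λ_ x).hom ≫ (ρ_ x).inv := by
      have h1 : (η ≫ x ◁ φ) ▷ x ≫ (α_ _ _ _).hom ≫ x ◁ e
          = η ▷ x ≫ (α_ _ _ _).hom ≫ x ◁ ε := by
        rw [← hφ]; simp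
      rw [h1, ← cancel_mono (ρ_ x).hom, ← cancel_epi (λ_ x).inv]
      simpa using h.symm
    exact ⟨D, ⟨{ coevaluation' := η ≫ x ◁ φ, evaluation' := e,
                 coevaluation_evaluation' := zigzag_aux _ _ hz inj,
                 evaluation_coevaluation' := hz }⟩⟩
end
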